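/- L²-based maximal regularity for the fractional heat equation in Fourier variables (the p = q = 2 case of Proposition pro-F_heat): Let d ≥ 1, α ≥ 0, ν > 0, δ₀ ∈ ℝ, T ∈ (0,∞], and let 1 < r ≤ m < ∞ with m ≥ 2. There exist constants C₁ = C₁(α,d,δ₀,m,ν,r) > 0 and C₂ = C₂(α,d,δ₀,m,ν) > 0 such that the following holds. Let w̃₀ : ℝ^d → ℂ and f̃ : (0,T) × ℝ^d → ℂ be measurable, with τ ↦ f̃(τ,ξ) locally integrable on (0,T) for almost every ξ, and define ŵ(t,ξ) := e^{−νt|ξ|^{2α}}·w̃₀(ξ) + ∫₀ᵗ e^{−ν(t−τ)|ξ|^{2α}}·f̃(τ,ξ) dτ. Then ( ∫₀^T ( ∫_{ℝ^d} |ξ|^{2(δ₀+2α+2α/m)} |ŵ(t,ξ)|² dξ )^{m/2} dt )^{1/m} ≤ C₁·( ∫₀^T ( ∫_{ℝ^d} |ξ|^{2(δ₀+2α/r)} |f̃(t,ξ)|² dξ )^{r/2} dt )^{1/r} + C₂·( ∫_{ℝ^d} |ξ|^{2(δ₀+2α)} |w̃₀(ξ)|² dξ )^{1/2}, understood as an inequality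 in [0,∞]. -/

import Mathlib

open MeasureTheory Real intervalIntegral
open scoped ENNReal NNReal

noncomputable section

/-- The time interval `(0,T)` for `T ∈ (0,∞]`, as a subset of `ℝ`. -/
def timeInterval (T : ℝ≥0∞) : Set ℝ := {t : ℝ | 0 < t ∧ ENNReal.ofReal t < T}

/-- The Duhamel solution of `∂ₜw + ν(−Δ)^α w = f` on the Fourier side:
`ŵ(t,ξ) = e^{−νt|ξ|^{2α}} w₀(ξ) + ∫₀ᵗ e^{−ν(t−τ)|ξ|^{2α}} f(τ,ξ) dτ`. -/
def duhamelFourier (d : ℕ) (α ν : ℝ) (w₀ : EuclideanSpace ℝ (Fin d) → ℂ)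
    (f : ℝ → EuclideanSpace ℝ (Fin d) → ℂ) (t : ℝ) (ξ : EuclideanSpace ℝ (Fin d)) : ℂ :=
  Real.exp (-(ν * t) * ‖ξ‖ ^ (2 * α)) • w₀ ξ +
    ∫ τ in (0 : ℝ)..t, Real.exp (-(ν * (t - τ)) * ‖ξ‖ ^ (2 * α)) • f τ ξ


lemma fh_le_of_le_mul_rpow {A D : ℝ≥0∞} {p q : ℝ} (hpq : q.HolderConjugate p) (hA : A ≠ ⊤)
    (h : A ≤ D * A ^ (1 / p)) : A ^ (1 / q) ≤ D := by
  have hq := hpq.pos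
  have hp := hpq.symm.pos
  rcases eq_or_ne A 0 with rfl | h0
  · rw [ENNReal.zero_rpow_of_pos (by positivity)]; exact zero_le
  have e : A = A ^ (1 / q) * A ^ (1 / p) := by
    rw [← ENNReal.rpow_add _ _ h0 hA]
    have := hpq.inv_add_inv_eq_one
    rw [one_div, one_div, this, ENNReal.rpow_one]
  have h1 : A ^ (1 / p) ≠ 0 := by
    simp [ENNReal.rpow_eq_zero_iff, h0, hA]
  have h2 : A ^ (1 / p) ≠ ⊤ := ENNReal.rpow_ne_top_of_nonneg (by positivity) hA
  rw [e] at h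
  have h3 : A ^ (1 / q) * A ^ (1 / p) ≤ D * A ^ (1 / p) := by
    refine h.trans ?_
    rw [← e]
  exact (ENNReal.mul_le_mul_iff_left h1 h2).1 h3

/-- duality -/
lemma fh_duality {β : Type*} [MeasurableSpace β] (μ : Measure β) [SigmaFinite μ]
    {F : β → ℝ≥0∞} (hF : Measurable F) {p q : ℝ} (hpq : q.HolderConjugate p) (D : ℝ≥0∞)
    (h : ∀ φ : β → ℝ≥0∞, Measurable φ → ∫⁻ y, F y * φ y ∂μ ≤ D * (∫⁻ y, φ y ^ p ∂μ) ^ (1 / p)) :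
    (∫⁻ y, F y ^ q ∂μ) ^ (1 / q) ≤ D := by
  have hq := hpq.pos
  have hp := hpq.symm.pos
  have hq1 := hpq.lt
  let G : ℕ → β → ℝ≥0∞ := fun n => (spanningSets μ n).indicator (fun y => min (F y) n)
  have hGm : ∀ n, Measurable (G n) := fun n =>
    (hF.min measurable_const).indicator (measurableSet_spanningSets μ n)
  have hGF : ∀ n y, G n y ≤ F y := fun n y =>
    (Set.indicator_le_self _ _ _).trans (min_le_left _ _)
  have hGmono : Monotone G := by
    intro i j hij y
    refine (Set.indicator_le_indicator_of_subset (monotone_spanningSets μ hij)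
      (fun _ => zero_le) y).trans ?_
    refine Set.indicator_le_indicator ?_
    exact min_le_min le_rfl (by exact_mod_cast hij)
  have hGsup : ∀ y, ⨆ n, G n y ^ q = F y ^ q := by
    intro y
    have ht : Filter.Tendsto (fun n : ℕ => G n y) Filter.atTop (nhds (F y)) := by
      have h1 : Filter.Tendsto (fun n : ℕ => min (F y) (n : ℝ≥0∞)) Filter.atTop
          (nhds (min (F y) ⊤)) := tendsto_const_nhds.min ENNReal.tendsto_nat_nhds_top
      rw [min_eq_left le_top] at h1
      refine h1.congr' ?_
      obtain ⟨N, hN⟩ : ∃ N, y ∈ spanningSets μ N := by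
        have : y ∈ ⋃ n, spanningSets μ n := by rw [iUnion_spanningSets]; trivial
        exact Set.mem_iUnion.1 this
      filter_upwards [Filter.eventually_ge_atTop N] with n hn
      exact (Set.indicator_of_mem (monotone_spanningSets μ hn hN) (fun y => min (F y) (n : ℝ≥0∞))).symm
    have ht2 := (ENNReal.continuous_rpow_const (y := q)).continuousAt.tendsto.comp ht
    refine (tendsto_nhds_unique ht2 (tendsto_atTop_iSup ?_)).symm
    intro i j hij
    exact ENNReal.rpow_le_rpow (hGmono hij y) hq.le
  have key : ∀ n, (∫⁻ y, G n y ^ q ∂μ) ≤ D ^ q := by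
    intro n
    have hfin : (∫⁻ y, G n y ^ q ∂μ) ≠ ⊤ := by
      have : (∫⁻ y, G n y ^ q ∂μ) ≤ ∫⁻ y, (spanningSets μ n).indicator (fun _ => (n : ℝ≥0∞) ^ q) y ∂μ := by
        refine lintegral_mono fun y => ?_
        by_cases hy : y ∈ spanningSets μ n
        · simp only [G, Set.indicator_of_mem hy]
          exact ENNReal.rpow_le_rpow (min_le_right _ _) hq.le
        · simp [G, Set.indicator_of_notMem hy, hq]
      refine ne_top_of_le_ne_top ?_ this
      rw [lintegral_indicator_const (measurableSet_spanningSets μ n)]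
      exact ENNReal.mul_ne_top (ENNReal.rpow_ne_top_of_nonneg hq.le (by simp))
        (measure_spanningSets_lt_top μ n).ne
    have h1 := h (fun y => G n y ^ (q - 1)) ((hGm n).pow_const _)
    have e : ∀ y, (G n y ^ (q - 1)) ^ p = G n y ^ q := by
      intro y
      rw [← ENNReal.rpow_mul, hpq.sub_one_mul_conj]
    simp only [e] at h1
    have h2 : (∫⁻ y, G n y ^ q ∂μ) ≤ ∫⁻ y, F y * G n y ^ (q - 1) ∂μ := by
      refine lintegral_mono fun y => ?_
      have : G n y ^ q = G n y * G n y ^ (q - 1) := by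
        conv_lhs => rw [show q = 1 + (q - 1) by ring]
        rw [ENNReal.rpow_add_of_nonneg _ _ zero_le_one (by linarith), ENNReal.rpow_one]
      simp only [this]
      gcongr
      exact hGF n y
    have h3 := fh_le_of_le_mul_rpow hpq hfin (h2.trans h1)
    rw [one_div] at h3
    exact (ENNReal.rpow_inv_le_iff hq).1 h3
  rw [one_div, ENNReal.rpow_inv_le_iff hq]
  simp only [← hGsup]
  rw [lintegral_iSup (fun n => (hGm n).pow_const _)
    (fun i j hij y => ENNReal.rpow_le_rpow (hGmono hij y) hq.le)]
  exact iSup_le key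

lemma fh_minkowski {α β : Type*} [MeasurableSpace α] [MeasurableSpace β] (μ : Measure α) (ν : Measure β)
    [SigmaFinite μ] [SigmaFinite ν] {F : α → β → ℝ≥0∞} (hF : Measurable (Function.uncurry F))
    {q : ℝ} (hq : 1 ≤ q) :
    (∫⁻ y, (∫⁻ x, F x y ∂μ) ^ q ∂ν) ^ (1 / q) ≤ ∫⁻ x, (∫⁻ y, F x y ^ q ∂ν) ^ (1 / q) ∂μ := by
  rcases hq.eq_or_lt with rfl | hq1
  · simp only [ENNReal.rpow_one, one_div, inv_one]
    rw [lintegral_lintegral_swap hF.aemeasurable]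
  have hpq := Real.HolderConjugate.conjExponent hq1
  have hFy : Measurable fun y => ∫⁻ x, F x y ∂μ :=
    Measurable.lintegral_prod_left hF
  refine fh_duality ν hFy hpq _ ?_
  intro φ hφ
  calc ∫⁻ y, (∫⁻ x, F x y ∂μ) * φ y ∂ν = ∫⁻ y, ∫⁻ x, F x y * φ y ∂μ ∂ν := by
        refine lintegral_congr fun y => ?_
        rw [lintegral_mul_const]
        exact hF.comp (by fun_prop : Measurable fun x => (x, y))
    _ = ∫⁻ x, ∫⁻ y, F x y * φ y ∂ν ∂μ := by
        rw [lintegral_lintegral_swap]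
        refine Measurable.aemeasurable ?_
        exact (hF.comp measurable_swap).mul (hφ.comp measurable_fst)
    _ ≤ ∫⁻ x, (∫⁻ y, F x y ^ q ∂ν) ^ (1 / q) * (∫⁻ y, φ y ^ q.conjExponent ∂ν) ^ (1 / q.conjExponent) ∂μ := by
        refine lintegral_mono fun x => ?_
        exact ENNReal.lintegral_mul_le_Lp_mul_Lq ν hpq
          (hF.comp (by fun_prop : Measurable fun y => (x, y))).aemeasurable hφ.aemeasurable
    _ = _ := by
        rw [lintegral_mul_const]
        refine Measurable.pow_const ?_ _
        exact Measurable.lintegral_prod_right (f := fun x y => F x y ^ q) (hF.pow_const q)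

/-- dyadic Hardy-Littlewood maximal function -/
def fhMax (φ : ℝ → ℝ≥0∞) (x : ℝ) : ℝ≥0∞ :=
  ⨆ n : ℤ, (ENNReal.ofReal ((2 : ℝ) ^ n))⁻¹ * ∫⁻ y in Metric.closedBall x ((2 : ℝ) ^ n), φ y

lemma fhMax_measurable {φ : ℝ → ℝ≥0∞} (hφ : Measurable φ) : Measurable (fhMax φ) := by
  refine Measurable.iSup fun n => Measurable.const_mul ?_ _
  have : ∀ x : ℝ, ∫⁻ y in Metric.closedBall x ((2 : ℝ) ^ n), φ y
      = ∫⁻ y, {z : ℝ × ℝ | dist z.2 z.1 ≤ (2 : ℝ) ^ n}.indicator (fun z => φ z.2) (x, y) := by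
    intro x
    rw [← lintegral_indicator Metric.isClosed_closedBall.measurableSet]
    rfl
  simp only [this]
  refine Measurable.lintegral_prod_right' ?_
  refine (hφ.comp measurable_snd).indicator ?_
  exact measurableSet_le (by fun_prop) measurable_const

lemma fhMax_weak {φ : ℝ → ℝ≥0∞} (s : ℝ≥0∞) (hs0 : s ≠ 0) (hs : s ≠ ⊤) :
    volume {x | s < fhMax φ x} ≤ 10 * s⁻¹ * ∫⁻ y, φ y := by
  by_cases hI : ∫⁻ y, φ y = ⊤
  · rw [hI, ENNReal.mul_top]
    · exact le_top
    · simp [hs]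
  set E := {x | s < fhMax φ x} with hE
  have h1 : ∀ x ∈ E, ∃ n : ℤ, s * ENNReal.ofReal ((2 : ℝ) ^ n) ≤
      ∫⁻ y in Metric.closedBall x ((2 : ℝ) ^ n), φ y := by
    intro x hx
    have hx' : s < fhMax φ x := hx
    obtain ⟨n, hn⟩ := lt_iSup_iff.1 hx'
    refine ⟨n, ?_⟩
    have hpos : (0 : ℝ) < 2 ^ n := by positivity
    have h := hn.le
    rw [mul_comm, ← div_eq_mul_inv] at h
    rwa [ENNReal.le_div_iff_mul_le (Or.inl (by simpa using hpos)) (Or.inl ENNReal.ofReal_ne_top)] at h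
  choose! n hn using h1
  let r : ℝ → ℝ := fun x => 2 ^ (n x)
  have hr0 : ∀ x, 0 < r x := fun x => by positivity
  have hR : ∀ a ∈ E, r a ≤ ((∫⁻ y, φ y) / s).toReal := by
    intro a ha
    rw [← ENNReal.ofReal_le_iff_le_toReal (ENNReal.div_ne_top hI hs0),
      ENNReal.le_div_iff_mul_le (Or.inl hs0) (Or.inl hs), mul_comm]
    exact (hn a ha).trans (setLIntegral_le_lintegral _ _)
  obtain ⟨u, huE, hdisj, hcov⟩ :=
    Vitali.exists_disjoint_subfamily_covering_enlargement_closedBall E (fun x => x) r _ hR 5 (by norm_num)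
  have hcount : u.Countable := hdisj.countable_of_nonempty_interior fun a _ =>
    ⟨a, by
      refine interior_mono Metric.ball_subset_closedBall ?_
      rw [Metric.isOpen_ball.interior_eq]
      exact Metric.mem_ball_self (hr0 a)⟩
  have hsub : E ⊆ ⋃ b ∈ u, Metric.closedBall b (5 * r b) := by
    intro x hx
    obtain ⟨b, hb, hxb⟩ := hcov x hx
    exact Set.mem_biUnion hb (hxb (Metric.mem_closedBall_self (hr0 x).le))
  calc volume E ≤ volume (⋃ b ∈ u, Metric.closedBall b (5 * r b)) := measure_mono hsub
    _ ≤ ∑' b : u, volume (Metric.closedBall (b : ℝ) (5 * r b)) := measure_biUnion_le _ hcount _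
    _ ≤ ∑' b : u, 10 * s⁻¹ * ∫⁻ y in Metric.closedBall (b : ℝ) (r b), φ y := by
        refine ENNReal.tsum_le_tsum fun b => ?_
        rw [Real.volume_closedBall, show 2 * (5 * r b) = 10 * r b by ring,
          ENNReal.ofReal_mul (by norm_num), mul_assoc]
        have := hn b (huE b.2)
        have h10 : ENNReal.ofReal 10 = 10 := by norm_num
        rw [h10]
        gcongr
        calc ENNReal.ofReal (r b) = s⁻¹ * (s * ENNReal.ofReal (r b)) := by
              rw [← mul_assoc, ENNReal.inv_mul_cancel hs0 hs, one_mul]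
          _ ≤ _ := by gcongr
    _ = 10 * s⁻¹ * ∫⁻ y in ⋃ b ∈ u, Metric.closedBall (b : ℝ) (r b), φ y := by
        rw [ENNReal.tsum_mul_left, lintegral_biUnion hcount
          (fun _ _ => Metric.isClosed_closedBall.measurableSet) hdisj]
    _ ≤ _ := mul_le_mul_right (setLIntegral_le_lintegral _ _) _

lemma fhMax_split (φ : ℝ → ℝ≥0∞) (s : ℝ≥0∞) (x : ℝ) :
    fhMax φ x ≤ fhMax ({y | s < φ y}.indicator φ) x + 2 * s := by
  refine iSup_le fun n => ?_
  have hpos : (0 : ℝ) < 2 ^ n := by positivity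
  have h1 : ∫⁻ y in Metric.closedBall x ((2 : ℝ) ^ n), φ y ≤
      (∫⁻ y in Metric.closedBall x ((2 : ℝ) ^ n), {y | s < φ y}.indicator φ y)
        + s * ENNReal.ofReal (2 * 2 ^ n) := by
    rw [← Real.volume_closedBall x, ← setLIntegral_const, ← lintegral_add_right _ measurable_const]
    refine lintegral_mono fun y => ?_
    by_cases hy : s < φ y
    · simp [Set.indicator, hy]
    · simp [Set.indicator, hy]; exact not_lt.1 hy
  calc _ ≤ (ENNReal.ofReal ((2 : ℝ) ^ n))⁻¹ * ((∫⁻ y in Metric.closedBall x ((2 : ℝ) ^ n), {y | s < φ y}.indicator φ y)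
        + s * ENNReal.ofReal (2 * 2 ^ n)) := by gcongr
    _ = (ENNReal.ofReal ((2 : ℝ) ^ n))⁻¹ * (∫⁻ y in Metric.closedBall x ((2 : ℝ) ^ n), {y | s < φ y}.indicator φ y)
        + 2 * s := by
        rw [mul_add]
        congr 1
        rw [ENNReal.ofReal_mul (by norm_num), ENNReal.ofReal_ofNat]
        calc _ = ((ENNReal.ofReal ((2 : ℝ) ^ n))⁻¹ * ENNReal.ofReal ((2 : ℝ) ^ n)) * (2 * s) := by ring
          _ = _ := by
            rw [ENNReal.inv_mul_cancel (by simpa using hpos) ENNReal.ofReal_ne_top, one_mul]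
    _ ≤ _ := by
        gcongr
        exact le_iSup (fun n : ℤ => (ENNReal.ofReal ((2 : ℝ) ^ n))⁻¹ *
          ∫⁻ y in Metric.closedBall x ((2 : ℝ) ^ n), {y | s < φ y}.indicator φ y) n

lemma fh_layer_real (p : ℝ) (hp : 0 < p) (a : ℝ) (ha : 0 ≤ a) :
    ∫⁻ s in Set.Ioo 0 a, ENNReal.ofReal (p * s ^ (p - 1)) = ENNReal.ofReal (a ^ p) := by
  have hint : IntervalIntegrable (fun s : ℝ => p * s ^ (p - 1)) volume 0 a :=
    (intervalIntegral.intervalIntegrable_rpow' (by linarith)).const_mul p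
  have h1 : ∫ s in (0 : ℝ)..a, p * s ^ (p - 1) = a ^ p := by
    rw [intervalIntegral.integral_const_mul, integral_rpow (Or.inl (by linarith))]
    rw [sub_add_cancel, Real.zero_rpow hp.ne']
    field_simp
    ring
  rw [← h1, intervalIntegral.integral_of_le ha, ofReal_integral_eq_lintegral_ofReal]
  · rw [restrict_Ioo_eq_restrict_Ioc]
  · exact (intervalIntegrable_iff_integrableOn_Ioc_of_le ha).1 hint
  · filter_upwards [ae_restrict_mem measurableSet_Ioc] with s hs
    have := hs.1
    positivity

/-- layer cake for a single number -/
lemma fh_layer (p : ℝ) (hp : 0 < p) (a : ℝ≥0∞) :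
    ∫⁻ s in Set.Ioi (0 : ℝ), {s : ℝ | ENNReal.ofReal s < a}.indicator
      (fun s => ENNReal.ofReal (p * s ^ (p - 1))) s = a ^ p := by
  have hmeas : ∀ a : ℝ≥0∞, MeasurableSet {s : ℝ | ENNReal.ofReal s < a} := fun a =>
    measurableSet_lt ENNReal.measurable_ofReal measurable_const
  have hfin : ∀ a : ℝ, 0 ≤ a → ∫⁻ s in Set.Ioi (0 : ℝ), {s : ℝ | ENNReal.ofReal s < ENNReal.ofReal a}.indicator
      (fun s => ENNReal.ofReal (p * s ^ (p - 1))) s = (ENNReal.ofReal a) ^ p := by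
    intro a ha
    rw [lintegral_indicator (hmeas _), Measure.restrict_restrict (hmeas _),
      ENNReal.ofReal_rpow_of_nonneg ha hp.le, ← fh_layer_real p hp a ha]
    congr 2
    ext s
    simp only [Set.mem_inter_iff, Set.mem_ofPred_eq, Set.mem_Ioi, Set.mem_Ioo]
    constructor
    · rintro ⟨h1, h2⟩
      exact ⟨h2, (ENNReal.ofReal_lt_ofReal_iff_of_nonneg h2.le).1 h1⟩
    · rintro ⟨h1, h2⟩
      exact ⟨(ENNReal.ofReal_lt_ofReal_iff_of_nonneg h1.le).2 h2, h1⟩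
  rcases eq_or_ne a ⊤ with rfl | ha
  · rw [ENNReal.top_rpow_of_pos hp]
    have h2 : ∀ n : ℕ, ((n : ℝ≥0∞)) ^ p ≤ ∫⁻ s in Set.Ioi (0 : ℝ), {s : ℝ | ENNReal.ofReal s < ⊤}.indicator
      (fun s => ENNReal.ofReal (p * s ^ (p - 1))) s := by
      intro n
      have := hfin n (by positivity)
      rw [ENNReal.ofReal_natCast] at this
      rw [← this]
      refine lintegral_mono fun s => ?_
      refine Set.indicator_le_indicator_of_subset ?_ (fun _ => zero_le) s
      intro s hs
      have hs' : ENNReal.ofReal s < (n : ℝ≥0∞) := hs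
      exact lt_of_lt_of_le hs' le_top
    have h3 := (ENNReal.continuous_rpow_const (y := p)).continuousAt.tendsto.comp ENNReal.tendsto_nat_nhds_top
    rw [ENNReal.top_rpow_of_pos hp] at h3
    exact top_le_iff.1 (le_of_tendsto' h3 h2)
  · lift a to ℝ≥0 using ha
    have := hfin a a.2
    simpa using this

lemma fhMax_strong (p : ℝ) (hp : 1 < p) : ∃ C : ℝ≥0∞, C ≠ ⊤ ∧ ∀ φ : ℝ → ℝ≥0∞, Measurable φ →
    ∫⁻ x, fhMax φ x ^ p ≤ C * ∫⁻ x, φ x ^ p := by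
  refine ⟨20 * ENNReal.ofReal (p / (p - 1)) * 4 ^ (p - 1), ?_, ?_⟩
  · refine ENNReal.mul_ne_top (ENNReal.mul_ne_top (by simp) ENNReal.ofReal_ne_top) ?_
    exact ENNReal.rpow_ne_top_of_nonneg (by linarith) (by simp)
  intro φ hφ
  have hp0 : 0 < p := by linarith
  have hp1 : 0 < p - 1 := by linarith
  have hM := fhMax_measurable hφ
  have hw : Measurable fun s : ℝ => ENNReal.ofReal (p * s ^ (p - 1)) := by fun_prop
  have hw' : Measurable fun s : ℝ => ENNReal.ofReal ((p - 1) * s ^ (p - 1 - 1)) := by fun_prop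
  calc ∫⁻ x, fhMax φ x ^ p
      = ∫⁻ x, ∫⁻ s in Set.Ioi (0 : ℝ), {s : ℝ | ENNReal.ofReal s < fhMax φ x}.indicator
          (fun s => ENNReal.ofReal (p * s ^ (p - 1))) s := by
        simp only [fh_layer p hp0]
    _ = ∫⁻ s in Set.Ioi (0 : ℝ), ∫⁻ x, {s : ℝ | ENNReal.ofReal s < fhMax φ x}.indicator
          (fun s => ENNReal.ofReal (p * s ^ (p - 1))) s := by
        refine lintegral_lintegral_swap (Measurable.aemeasurable ?_)
        exact Measurable.indicator (f := fun z : ℝ × ℝ => ENNReal.ofReal (p * z.2 ^ (p - 1)))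
          (s := {z : ℝ × ℝ | ENNReal.ofReal z.2 < fhMax φ z.1})
          (hw.comp measurable_snd)
          (measurableSet_lt (by fun_prop) (hM.comp measurable_fst))
    _ ≤ ∫⁻ s in Set.Ioi (0 : ℝ), ∫⁻ x, 20 * ENNReal.ofReal (p / (p - 1)) *
          ({s : ℝ | ENNReal.ofReal s < 4 * φ x}.indicator
          (fun s => ENNReal.ofReal ((p - 1) * s ^ (p - 1 - 1))) s * φ x) := by
        refine setLIntegral_mono' measurableSet_Ioi fun s hs => ?_
        have hs : 0 < s := hs
        have hS0 : ENNReal.ofReal s ≠ 0 := by simpa using hs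
        have e1 : ∫⁻ x, {s : ℝ | ENNReal.ofReal s < fhMax φ x}.indicator
            (fun s => ENNReal.ofReal (p * s ^ (p - 1))) s
            = ENNReal.ofReal (p * s ^ (p - 1)) * volume {x | ENNReal.ofReal s < fhMax φ x} := by
          rw [← lintegral_indicator_const (measurableSet_lt measurable_const hM)]
          rfl
        have e2 : volume {x | ENNReal.ofReal s < fhMax φ x} ≤
            10 * (ENNReal.ofReal (s / 2))⁻¹ * ∫⁻ y, {y | ENNReal.ofReal (s / 4) < φ y}.indicator φ y := by
          refine le_trans (measure_mono ?_) (fhMax_weak (φ := {y | ENNReal.ofReal (s / 4) < φ y}.indicator φ)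
            (ENNReal.ofReal (s / 2)) (by simpa using hs) ENNReal.ofReal_ne_top)
          intro x hx
          have h1 := lt_of_lt_of_le hx (fhMax_split φ (ENNReal.ofReal (s / 4)) x)
          have h2 : 2 * ENNReal.ofReal (s / 4) = ENNReal.ofReal (s / 2) := by
            rw [← ENNReal.ofReal_ofNat, ← ENNReal.ofReal_mul (by norm_num)]
            congr 1; ring
          have h3 : ENNReal.ofReal s = ENNReal.ofReal (s / 2) + ENNReal.ofReal (s / 2) := by
            rw [← ENNReal.ofReal_add (by positivity) (by positivity)]; congr 1; ring
          rw [h2, h3] at h1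
          exact (ENNReal.add_lt_add_iff_right ENNReal.ofReal_ne_top).1 h1
        rw [e1]
        refine (mul_le_mul_right e2 _).trans (le_of_eq ?_)
        have e3 : ∀ y, {s : ℝ | ENNReal.ofReal s < 4 * φ y}.indicator
            (fun s => ENNReal.ofReal ((p - 1) * s ^ (p - 1 - 1))) s * φ y
            = ENNReal.ofReal ((p - 1) * s ^ (p - 1 - 1)) *
              {y | ENNReal.ofReal (s / 4) < φ y}.indicator φ y := by
          intro y
          have : ENNReal.ofReal s < 4 * φ y ↔ ENNReal.ofReal (s / 4) < φ y := by
            have h4 : ENNReal.ofReal s = 4 * ENNReal.ofReal (s / 4) := by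
              rw [← ENNReal.ofReal_ofNat 4, ← ENNReal.ofReal_mul (by norm_num)]
              congr 1; ring
            rw [h4, ENNReal.mul_lt_mul_iff_right (by simp) (by simp)]
          by_cases hy : ENNReal.ofReal (s / 4) < φ y
          · simp [Set.indicator, this, hy]
          · simp [Set.indicator, this, hy]
        have hms : MeasurableSet {y | ENNReal.ofReal (s / 4) < φ y} := measurableSet_lt measurable_const hφ
        simp only [e3]
        rw [lintegral_const_mul _ ((hφ.indicator hms).const_mul _), lintegral_const_mul _ (hφ.indicator hms)]
        rw [← mul_assoc, ← mul_assoc, ← mul_assoc]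
        congr 1
        rw [← ENNReal.ofReal_inv_of_pos (by positivity), ← ENNReal.ofReal_ofNat 10, ← ENNReal.ofReal_ofNat 20,
          ← ENNReal.ofReal_mul (by positivity), ← ENNReal.ofReal_mul (by positivity),
          ← ENNReal.ofReal_mul (by positivity), ← ENNReal.ofReal_mul (by positivity)]
        congr 1
        rw [Real.rpow_sub_one hs.ne' (p - 1)]
        field_simp
        ring
    _ = ∫⁻ x, ∫⁻ s in Set.Ioi (0 : ℝ), 20 * ENNReal.ofReal (p / (p - 1)) *
          ({s : ℝ | ENNReal.ofReal s < 4 * φ x}.indicator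
          (fun s => ENNReal.ofReal ((p - 1) * s ^ (p - 1 - 1))) s * φ x) := by
        refine lintegral_lintegral_swap (Measurable.aemeasurable ?_)
        refine Measurable.const_mul (Measurable.mul ?_ (hφ.comp measurable_snd)) _
        exact Measurable.indicator (f := fun z : ℝ × ℝ => ENNReal.ofReal ((p - 1) * z.1 ^ (p - 1 - 1)))
          (s := {z : ℝ × ℝ | ENNReal.ofReal z.1 < 4 * φ z.2})
          (hw'.comp measurable_fst)
          (measurableSet_lt (by fun_prop) ((hφ.comp measurable_snd).const_mul _))
    _ = ∫⁻ x, (20 * ENNReal.ofReal (p / (p - 1)) * 4 ^ (p - 1)) * φ x ^ p := by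
        refine lintegral_congr fun x => ?_
        have hms : MeasurableSet {s : ℝ | ENNReal.ofReal s < 4 * φ x} :=
          measurableSet_lt ENNReal.measurable_ofReal measurable_const
        rw [lintegral_const_mul _ ((hw'.indicator hms).mul_const _), lintegral_mul_const _ (hw'.indicator hms),
          fh_layer (p - 1) hp1, ENNReal.mul_rpow_of_nonneg _ _ hp1.le]
        have : φ x ^ p = φ x ^ (p - 1) * φ x := by
          conv_lhs => rw [show p = (p - 1) + 1 by ring]
          rw [ENNReal.rpow_add_of_nonneg _ _ hp1.le zero_le_one, ENNReal.rpow_one]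
        rw [this]; ring
    _ = _ := lintegral_const_mul _ (hφ.pow_const _)

/-- causal exponential kernel -/
def fhK (l s : ℝ) : ℝ≥0∞ := if 0 < s then ENNReal.ofReal (Real.exp (-(l * s))) else 0

lemma fhK_measurable : Measurable (fun z : ℝ × ℝ => fhK z.1 z.2) := by
  unfold fhK
  exact Measurable.ite (measurableSet_lt measurable_const measurable_snd) (by fun_prop) measurable_const

lemma fhK_meas {β : Type*} [MeasurableSpace β] {a b : β → ℝ} (ha : Measurable a) (hb : Measurable b) :
    Measurable (fun z => fhK (a z) (b z)) :=
  fhK_measurable.comp (ha.prodMk hb)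

lemma fhK_le_one {l s : ℝ} (hl : 0 ≤ l) : fhK l s ≤ 1 := by
  unfold fhK
  split_ifs with h
  · rw [← ENNReal.ofReal_one]
    refine ENNReal.ofReal_le_ofReal ?_
    rw [Real.exp_le_one_iff]
    have := mul_nonneg hl h.le
    linarith
  · exact zero_le

lemma fhK_rpow {l s a : ℝ} (ha : 0 < a) : fhK l s ^ a = fhK (a * l) s := by
  unfold fhK
  split_ifs with h
  · rw [ENNReal.ofReal_rpow_of_pos (Real.exp_pos _), ← Real.exp_mul]
    congr 2; ring
  · exact ENNReal.zero_rpow_of_pos ha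

lemma fhK_lintegral {l : ℝ} (hl : 0 < l) : ∫⁻ s, fhK l s = (ENNReal.ofReal l)⁻¹ := by
  have h1 : ∀ s, fhK l s = (Set.Ioi (0 : ℝ)).indicator (fun s => ENNReal.ofReal (Real.exp ((-l) * s))) s := by
    intro s
    simp [fhK, Set.indicator]
  simp only [h1]
  rw [lintegral_indicator measurableSet_Ioi,
    ← ofReal_integral_eq_lintegral_ofReal (integrableOn_exp_mul_Ioi (by linarith) 0)
      (Filter.Eventually.of_forall fun _ => (Real.exp_pos _).le),
    integral_exp_mul_Ioi (by linarith), ← ENNReal.ofReal_inv_of_pos hl]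
  congr 1
  simp

lemma fhK_lintegral_rpow_le {l a : ℝ} (hl : 0 < l) (ha : 1 ≤ a) :
    ∫⁻ s, fhK l s ^ a ≤ (ENNReal.ofReal l)⁻¹ := by
  simp only [fhK_rpow (by linarith : 0 < a)]
  rw [fhK_lintegral (by positivity)]
  refine ENNReal.inv_le_inv.2 (ENNReal.ofReal_le_ofReal ?_)
  nlinarith

lemma fhK_pointwise {l : ℝ} {n : ℤ} (h1 : (2 : ℝ) ^ n ≤ l⁻¹) (h2 : l⁻¹ < 2 ^ (n + 1)) (hl : 0 < l) (s : ℝ) :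
    ∃ k : ℕ, ENNReal.ofReal l * fhK l s ≤
      ENNReal.ofReal (32 / 4 ^ k / 2 ^ n) ∧ (fhK l s ≠ 0 → |s| ≤ 2 ^ (n + k)) := by
  by_cases hs : 0 < s
  swap
  · exact ⟨0, by simp [fhK, hs], by simp [fhK, hs]⟩
  have hpn : (0 : ℝ) < 2 ^ n := by positivity
  have hex : ∃ k : ℕ, s ≤ 2 ^ n * 2 ^ k := by
    obtain ⟨k, hk⟩ := pow_unbounded_of_one_lt (s / 2 ^ n) (by norm_num : (1 : ℝ) < 2)
    refine ⟨k, ?_⟩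
    rw [div_lt_iff₀ hpn] at hk
    linarith
  classical
  refine ⟨Nat.find hex, ?_, ?_⟩
  swap
  · intro _
    rw [abs_of_pos hs, zpow_add₀ (by norm_num), zpow_natCast]
    exact Nat.find_spec hex
  have hK : fhK l s = ENNReal.ofReal (Real.exp (-(l * s))) := by simp [fhK, hs]
  rw [hK, ← ENNReal.ofReal_mul hl.le]
  refine ENNReal.ofReal_le_ofReal ?_
  have hl1 : l ≤ 1 / 2 ^ n := by
    rw [le_div_iff₀ hpn]
    calc l * 2 ^ n ≤ l * l⁻¹ := by gcongr
      _ = 1 := mul_inv_cancel₀ hl.ne'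
  have hl2 : 1 ≤ l * (2 * 2 ^ n) := by
    have : (2 : ℝ) ^ (n + 1) = 2 * 2 ^ n := by rw [zpow_add₀ (by norm_num)]; simp; ring
    rw [this] at h2
    calc 1 = l * l⁻¹ := (mul_inv_cancel₀ hl.ne').symm
      _ ≤ _ := by gcongr
  have hexp : Real.exp (-(l * s)) ≤ 32 / 4 ^ (Nat.find hex) := by
    rcases hk : Nat.find hex with _ | j
    · have : Real.exp (-(l * s)) ≤ 1 := by
        rw [Real.exp_le_one_iff]; have := mul_pos hl hs; linarith
      norm_num; linarith
    · have hj : ¬ (s ≤ 2 ^ n * 2 ^ j) := Nat.find_min hex (by omega)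
      push Not at hj
      have hls : 2 ^ j / 2 ≤ l * s := by
        have : l * (2 ^ n * 2 ^ j) ≤ l * s := by gcongr
        have h3 : (1 : ℝ) * 2 ^ j ≤ l * (2 * 2 ^ n) * 2 ^ j := by gcongr
        nlinarith
      have hq := Real.quadratic_le_exp_of_nonneg (mul_pos hl hs).le
      have h4 : (4 : ℝ) ^ j / 8 ≤ Real.exp (l * s) := by
        have h5 : (4 : ℝ) ^ j = (2 ^ j) ^ 2 := by rw [← pow_mul, mul_comm, pow_mul]; norm_num
        have h6 : (2 ^ j / 2) ^ 2 ≤ (l * s) ^ 2 := by gcongr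
        have := mul_pos hl hs
        rw [h5]
        nlinarith
      rw [Real.exp_neg, inv_le_comm₀ (Real.exp_pos _) (by positivity)]
      refine le_trans (le_of_eq ?_) h4
      rw [pow_succ]; field_simp; norm_num
  calc l * Real.exp (-(l * s)) ≤ 1 / 2 ^ n * (32 / 4 ^ (Nat.find hex)) := by gcongr
    _ = _ := by ring

lemma fhK_max : ∃ C : ℝ≥0∞, C ≠ ⊤ ∧ ∀ φ : ℝ → ℝ≥0∞, Measurable φ → ∀ l : ℝ, 0 < l → ∀ τ : ℝ,
    ENNReal.ofReal l * ∫⁻ t, fhK l (t - τ) * φ t ≤ C * fhMax φ τ := by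
  refine ⟨∑' k : ℕ, 32 * (2⁻¹ : ℝ≥0∞) ^ k, ?_, ?_⟩
  · rw [ENNReal.tsum_mul_left, ENNReal.tsum_geometric]
    refine ENNReal.mul_ne_top (by simp) ?_
    simp
  intro φ hφ l hl τ
  obtain ⟨n, hn1, hn2⟩ := exists_mem_Ico_zpow (inv_pos.2 hl) (by norm_num : (1 : ℝ) < 2)
  have hpt : ∀ t, ENNReal.ofReal l * (fhK l (t - τ) * φ t) ≤
      ∑' k : ℕ, ENNReal.ofReal (32 / 4 ^ k / 2 ^ n) *
        (Metric.closedBall τ ((2 : ℝ) ^ (n + (k : ℤ)))).indicator φ t := by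
    intro t
    obtain ⟨k, hk1, hk2⟩ := fhK_pointwise hn1 hn2 hl (t - τ)
    by_cases h0 : fhK l (t - τ) = 0
    · simp [h0]
    refine le_trans ?_ (ENNReal.le_tsum k)
    have : t ∈ Metric.closedBall τ ((2 : ℝ) ^ (n + (k : ℤ))) := by
      rw [Metric.mem_closedBall, Real.dist_eq]; exact hk2 h0
    rw [Set.indicator_of_mem this, ← mul_assoc]
    gcongr
  have hmb : ∀ k : ℕ, MeasurableSet (Metric.closedBall τ ((2 : ℝ) ^ (n + (k : ℤ)))) := fun k =>
    Metric.isClosed_closedBall.measurableSet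
  rw [← lintegral_const_mul' _ _ ENNReal.ofReal_ne_top]
  refine (lintegral_mono hpt).trans ?_
  rw [lintegral_tsum fun k => ((hφ.indicator (hmb k)).const_mul _).aemeasurable, ← ENNReal.tsum_mul_right]
  refine ENNReal.tsum_le_tsum fun k => ?_
  rw [lintegral_const_mul _ (hφ.indicator (hmb k)), lintegral_indicator (hmb k)]
  have hM : (ENNReal.ofReal ((2 : ℝ) ^ (n + (k : ℤ))))⁻¹ *
      ∫⁻ y in Metric.closedBall τ ((2 : ℝ) ^ (n + (k : ℤ))), φ y ≤ fhMax φ τ :=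
    le_iSup (fun n : ℤ => (ENNReal.ofReal ((2 : ℝ) ^ n))⁻¹ *
      ∫⁻ y in Metric.closedBall τ ((2 : ℝ) ^ n), φ y) (n + (k : ℤ))
  refine le_trans (le_of_eq ?_) (mul_le_mul_right hM _)
  rw [← mul_assoc]
  congr 1
  have e : (2⁻¹ : ℝ≥0∞) = ENNReal.ofReal (2⁻¹) := by
    rw [ENNReal.ofReal_inv_of_pos (by norm_num)]; simp
  rw [e, ← ENNReal.ofReal_pow (by norm_num), ← ENNReal.ofReal_inv_of_pos (by positivity),
    ← ENNReal.ofReal_ofNat 32, ← ENNReal.ofReal_mul (by norm_num), ← ENNReal.ofReal_mul (by positivity)]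
  congr 1
  rw [zpow_add₀ (by norm_num), zpow_natCast, show (4 : ℝ) = 2 * 2 by norm_num, mul_pow, inv_pow]
  field_simp

lemma fh_shift_left (l τ : ℝ) (a : ℝ) : ∫⁻ t, fhK l (t - τ) ^ a = ∫⁻ s, fhK l s ^ a :=
  lintegral_sub_right_eq_self (fun s => fhK l s ^ a) τ

lemma fh_shift_right (l t : ℝ) : ∫⁻ τ, fhK l (t - τ) = ∫⁻ s, fhK l s :=
  lintegral_sub_left_eq_self (fun s => fhK l s) t

/-- weighted Hoelder -/
lemma fhK_holder {g : ℝ → ℝ≥0∞} (hg : Measurable g) {l : ℝ} (hl : 0 < l) {a : ℝ} (ha : 1 ≤ a) (t : ℝ) :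
    (∫⁻ τ, fhK l (t - τ) * g τ) ^ a ≤
      (ENNReal.ofReal l) ^ (1 - a) * ∫⁻ τ, fhK l (t - τ) * g τ ^ a := by
  rcases ha.eq_or_lt with rfl | ha1
  · simp
  have hpq := (Real.HolderConjugate.conjExponent ha1).symm
  set b := a.conjExponent
  have hb := hpq.pos
  have ha0 : 0 < a := by linarith
  have hkm : Measurable fun τ => fhK l (t - τ) := fhK_meas measurable_const (by fun_prop)
  have hsum : 1 / b + 1 / a = 1 := by
    have := hpq.inv_add_inv_eq_one
    simpa [one_div] using this
  have h1 := ENNReal.lintegral_mul_le_Lp_mul_Lq volume hpq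
    (f := fun τ => fhK l (t - τ) ^ (1 / b)) (g := fun τ => fhK l (t - τ) ^ (1 / a) * g τ)
    (hkm.pow_const _).aemeasurable ((hkm.pow_const _).mul hg).aemeasurable
  have e1 : ∀ τ, ((fun τ => fhK l (t - τ) ^ (1 / b)) * (fun τ => fhK l (t - τ) ^ (1 / a) * g τ)) τ
      = fhK l (t - τ) * g τ := by
    intro τ
    simp only [Pi.mul_apply]
    rw [← mul_assoc, ← ENNReal.rpow_add_of_nonneg _ _ (by positivity) (by positivity), hsum, ENNReal.rpow_one]
  have e2 : ∀ τ, (fhK l (t - τ) ^ (1 / b)) ^ b = fhK l (t - τ) := by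
    intro τ
    rw [← ENNReal.rpow_mul, one_div_mul_cancel hb.ne', ENNReal.rpow_one]
  have e3 : ∀ τ, (fhK l (t - τ) ^ (1 / a) * g τ) ^ a = fhK l (t - τ) * g τ ^ a := by
    intro τ
    rw [ENNReal.mul_rpow_of_nonneg _ _ ha0.le, ← ENNReal.rpow_mul, one_div_mul_cancel ha0.ne',
      ENNReal.rpow_one]
  simp only [e1, e2, e3] at h1
  rw [fh_shift_right, fhK_lintegral hl] at h1
  refine (ENNReal.rpow_le_rpow h1 ha0.le).trans (le_of_eq ?_)
  rw [ENNReal.mul_rpow_of_nonneg _ _ ha0.le, ← ENNReal.rpow_mul, ← ENNReal.rpow_mul,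
    one_div_mul_cancel ha0.ne', ENNReal.rpow_one, ← ENNReal.rpow_neg_one, ← ENNReal.rpow_mul]
  congr 2
  have : 1 / b = 1 - 1 / a := by linarith
  rw [this]; field_simp; ring

lemma fhK_young {g : ℝ → ℝ≥0∞} (hg : Measurable g) {l : ℝ} (hl : 0 < l) {r m : ℝ} (hr : 1 ≤ r) (hrm : r ≤ m) :
    ∫⁻ t, ((ENNReal.ofReal l) ^ (1 + 1 / m - 1 / r) * ∫⁻ τ, fhK l (t - τ) * g τ) ^ m ≤
      (∫⁻ τ, g τ ^ r) ^ (m / r) := by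
  have hr0 : 0 < r := by linarith
  have hm0 : 0 < m := by linarith
  set ℓ := ENNReal.ofReal l with hℓ
  have hℓ0 : ℓ ≠ 0 := by simpa [hℓ] using hl
  have hℓt : ℓ ≠ ⊤ := ENNReal.ofReal_ne_top
  have hkm2 : Measurable fun z : ℝ × ℝ => fhK l (z.1 - z.2) * g z.2 ^ r :=
    (fhK_meas measurable_const (by fun_prop)).mul ((hg.comp measurable_snd).pow_const r)
  set N := ∫⁻ τ, g τ ^ r with hN
  have hpt : ∀ t, (ℓ ^ (1 + 1 / m - 1 / r) * ∫⁻ τ, fhK l (t - τ) * g τ) ^ m ≤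
      (ℓ * N ^ (m / r - 1)) * ∫⁻ τ, fhK l (t - τ) * g τ ^ r := by
    intro t
    set J := ∫⁻ τ, fhK l (t - τ) * g τ ^ r with hJ
    have hJN : J ≤ N := by
      refine lintegral_mono fun τ => ?_
      calc fhK l (t - τ) * g τ ^ r ≤ 1 * g τ ^ r := by gcongr; exact fhK_le_one hl.le
        _ = _ := one_mul _
    have hmr : 0 ≤ m / r - 1 := by
      rw [sub_nonneg, le_div_iff₀ hr0]; linarith
    rw [ENNReal.mul_rpow_of_nonneg _ _ hm0.le, ← ENNReal.rpow_mul]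
    have h2 : (∫⁻ τ, fhK l (t - τ) * g τ) ^ m ≤ ℓ ^ ((1 - r) * (m / r)) * (N ^ (m / r - 1) * J) := by
      calc (∫⁻ τ, fhK l (t - τ) * g τ) ^ m = ((∫⁻ τ, fhK l (t - τ) * g τ) ^ r) ^ (m / r) := by
            rw [← ENNReal.rpow_mul]; congr 1; field_simp
        _ ≤ (ℓ ^ (1 - r) * J) ^ (m / r) := by
            gcongr
            exact fhK_holder hg hl hr t
        _ = ℓ ^ ((1 - r) * (m / r)) * (J ^ (m / r - 1) * J) := by
            rw [ENNReal.mul_rpow_of_nonneg _ _ (by positivity), ← ENNReal.rpow_mul]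
            congr 1
            conv_lhs => rw [show m / r = (m / r - 1) + 1 by ring]
            rw [ENNReal.rpow_add_of_nonneg _ _ hmr zero_le_one, ENNReal.rpow_one]
        _ ≤ _ := by gcongr
    refine (mul_le_mul_right h2 _).trans (le_of_eq ?_)
    rw [← mul_assoc, ← mul_assoc, ← ENNReal.rpow_add _ _ hℓ0 hℓt]
    congr 2
    conv_rhs => rw [← ENNReal.rpow_one ℓ]
    congr 1
    field_simp
    ring
  refine (lintegral_mono hpt).trans ?_
  rw [lintegral_const_mul _ (Measurable.lintegral_prod_right' hkm2),
    lintegral_lintegral_swap hkm2.aemeasurable]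
  have e : ∀ τ, ∫⁻ t, fhK l (t - τ) * g τ ^ r = ℓ⁻¹ * g τ ^ r := by
    intro τ
    rw [lintegral_mul_const _ (fhK_meas measurable_const (by fun_prop))]
    have := fh_shift_left l τ 1
    simp only [ENNReal.rpow_one] at this
    rw [this, fhK_lintegral hl]
  simp only [e]
  rw [lintegral_const_mul _ (hg.pow_const r)]
  have hmr : 0 ≤ m / r - 1 := by
    rw [sub_nonneg, le_div_iff₀ hr0]; linarith
  refine le_of_eq ?_
  calc ℓ * N ^ (m / r - 1) * (ℓ⁻¹ * N) = (ℓ * ℓ⁻¹) * (N ^ (m / r - 1) * N) := by ring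
    _ = N ^ (m / r - 1) * N := by rw [ENNReal.mul_inv_cancel hℓ0 hℓt, one_mul]
    _ = N ^ (m / r) := by
      conv_rhs => rw [show m / r = (m / r - 1) + 1 by ring]
      rw [ENNReal.rpow_add_of_nonneg _ _ hmr zero_le_one, ENNReal.rpow_one]

section core
variable {X : Type*} [MeasurableSpace X] (μ : Measure X) [SigmaFinite μ]

/-- the weighted Duhamel operator -/
def fhU (L : X → ℝ) (c : ℝ) (g : ℝ → X → ℝ≥0∞) (t : ℝ) (ξ : X) : ℝ≥0∞ :=
  (ENNReal.ofReal (L ξ)) ^ c * ∫⁻ τ, fhK (L ξ) (t - τ) * g τ ξ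

lemma fhU_measurable {L : X → ℝ} (hL : Measurable L) (c : ℝ) {g : ℝ → X → ℝ≥0∞}
    (hg : Measurable (Function.uncurry g)) : Measurable (Function.uncurry (fhU L c g)) := by
  refine Measurable.mul ((ENNReal.measurable_ofReal.comp (hL.comp measurable_snd)).pow_const c) ?_
  refine Measurable.lintegral_prod_right'
    (f := fun z : (ℝ × X) × ℝ => fhK (L z.1.2) (z.1.1 - z.2) * g z.2 z.1.2) ?_
  refine (fhK_meas (hL.comp (by fun_prop)) (by fun_prop)).mul ?_
  exact hg.comp (by fun_prop : Measurable fun z : (ℝ × X) × ℝ => (z.2, z.1.2))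

/-- Minkowski in the form used: `L^m_t L^2_ξ ≤ L^2_ξ L^m_t`. -/
lemma fh_mixed {U : ℝ → X → ℝ≥0∞} (hU : Measurable (Function.uncurry U)) {m : ℝ} (hm : 2 ≤ m) :
    (∫⁻ t, (∫⁻ ξ, U t ξ ^ (2 : ℝ) ∂μ) ^ (m / 2)) ^ (1 / m) ≤
      (∫⁻ ξ, (∫⁻ t, U t ξ ^ m) ^ (2 / m) ∂μ) ^ ((1 : ℝ) / 2) := by
  have hm0 : 0 < m := by linarith
  have h := fh_minkowski μ (volume : Measure ℝ) (F := fun ξ t => U t ξ ^ (2 : ℝ))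
    ((hU.comp measurable_swap).pow_const 2) (q := m / 2) (by linarith)
  have e1 : ∀ t ξ, (U t ξ ^ (2 : ℝ)) ^ (m / 2) = U t ξ ^ m := by
    intro t ξ
    rw [← ENNReal.rpow_mul]; congr 1; ring
  simp only [e1] at h
  rw [show 1 / (m / 2) = 2 / m by field_simp] at h
  calc _ = ((∫⁻ t, (∫⁻ ξ, U t ξ ^ (2 : ℝ) ∂μ) ^ (m / 2)) ^ (2 / m)) ^ ((1 : ℝ) / 2) := by
        rw [← ENNReal.rpow_mul]; congr 1; field_simp
    _ ≤ _ := ENNReal.rpow_le_rpow h (by norm_num)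

lemma fh_termA {L : X → ℝ} (hL : Measurable L) (hL0 : ∀ ξ, 0 < L ξ) {v : X → ℝ≥0∞} (hv : Measurable v)
    {m : ℝ} (hm : 2 ≤ m) :
    (∫⁻ t, (∫⁻ ξ, ((ENNReal.ofReal (L ξ)) ^ (1 / m) * fhK (L ξ) t * v ξ) ^ (2 : ℝ) ∂μ) ^ (m / 2)) ^ (1 / m)
      ≤ (∫⁻ ξ, v ξ ^ (2 : ℝ) ∂μ) ^ ((1 : ℝ) / 2) := by
  have hm0 : 0 < m := by linarith
  refine (fh_mixed μ (U := fun t ξ => (ENNReal.ofReal (L ξ)) ^ (1 / m) * fhK (L ξ) t * v ξ) ?_ hm).trans ?_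
  · refine Measurable.mul (Measurable.mul ?_ ?_) (hv.comp measurable_snd)
    · exact (ENNReal.measurable_ofReal.comp (hL.comp measurable_snd)).pow_const _
    · exact fhK_meas (hL.comp measurable_snd) measurable_fst
  refine ENNReal.rpow_le_rpow (lintegral_mono fun ξ => ?_) (by norm_num)
  have hℓ0 : ENNReal.ofReal (L ξ) ≠ 0 := by simpa using hL0 ξ
  have hℓt : ENNReal.ofReal (L ξ) ≠ ⊤ := ENNReal.ofReal_ne_top
  have e : ∀ t, (ENNReal.ofReal (L ξ) ^ (1 / m) * fhK (L ξ) t * v ξ) ^ m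
      = (ENNReal.ofReal (L ξ) * v ξ ^ m) * fhK (L ξ) t ^ m := by
    intro t
    rw [ENNReal.mul_rpow_of_nonneg _ _ hm0.le, ENNReal.mul_rpow_of_nonneg _ _ hm0.le, ← ENNReal.rpow_mul,
      one_div_mul_cancel hm0.ne', ENNReal.rpow_one]
    ring
  simp only [e]
  have hkm : Measurable fun t => fhK (L ξ) t := fhK_meas measurable_const measurable_id
  rw [lintegral_const_mul _ (hkm.pow_const m)]
  calc _ ≤ (ENNReal.ofReal (L ξ) * v ξ ^ m * (ENNReal.ofReal (L ξ))⁻¹) ^ (2 / m) := by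
        gcongr
        exact fhK_lintegral_rpow_le (hL0 ξ) (by linarith)
    _ = (v ξ ^ m) ^ (2 / m) := by
        congr 1
        rw [mul_comm, ← mul_assoc, ENNReal.inv_mul_cancel hℓ0 hℓt, one_mul]
    _ = _ := by
        rw [← ENNReal.rpow_mul]; congr 1; field_simp

lemma fh_case_le {L : X → ℝ} (hL : Measurable L) (hL0 : ∀ ξ, 0 < L ξ) {g : ℝ → X → ℝ≥0∞}
    (hg : Measurable (Function.uncurry g)) {m r : ℝ} (hm : 2 ≤ m) (hr1 : 1 < r) (hr : r ≤ 2) :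
    (∫⁻ t, (∫⁻ ξ, fhU L (1 + 1 / m - 1 / r) g t ξ ^ (2 : ℝ) ∂μ) ^ (m / 2)) ^ (1 / m) ≤
      (∫⁻ t, (∫⁻ ξ, g t ξ ^ (2 : ℝ) ∂μ) ^ (r / 2)) ^ (1 / r) := by
  have hm0 : 0 < m := by linarith
  have hr0 : 0 < r := by linarith
  refine (fh_mixed μ (fhU_measurable hL _ hg) hm).trans ?_
  have h1 : ∀ ξ, (∫⁻ t, fhU L (1 + 1 / m - 1 / r) g t ξ ^ m) ^ (2 / m) ≤
      (∫⁻ τ, g τ ξ ^ r) ^ (2 / r) := by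
    intro ξ
    have := fhK_young (g := fun τ => g τ ξ) (hg.comp (by fun_prop : Measurable fun τ => (τ, ξ)))
      (hL0 ξ) hr1.le (hr.trans hm)
    refine (ENNReal.rpow_le_rpow this (by positivity : 0 ≤ 2 / m)).trans (le_of_eq ?_)
    rw [← ENNReal.rpow_mul]; congr 1; field_simp
  have h2 := fh_minkowski (volume : Measure ℝ) μ (F := fun τ ξ => g τ ξ ^ r) (hg.pow_const r)
    (q := 2 / r) (by rw [le_div_iff₀ hr0]; linarith)
  have e1 : ∀ t ξ, (g t ξ ^ r) ^ (2 / r) = g t ξ ^ (2 : ℝ) := by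
    intro t ξ
    rw [← ENNReal.rpow_mul]; congr 1; field_simp
  simp only [e1] at h2
  rw [show 1 / (2 / r) = r / 2 by field_simp] at h2
  calc _ ≤ (∫⁻ ξ, (∫⁻ τ, g τ ξ ^ r) ^ (2 / r) ∂μ) ^ ((1 : ℝ) / 2) :=
        ENNReal.rpow_le_rpow (lintegral_mono h1) (by norm_num)
    _ = ((∫⁻ ξ, (∫⁻ τ, g τ ξ ^ r) ^ (2 / r) ∂μ) ^ (r / 2)) ^ (1 / r) := by
        rw [← ENNReal.rpow_mul]; congr 1; field_simp
    _ ≤ _ := ENNReal.rpow_le_rpow h2 (by positivity)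

/-- Hedberg-type interpolation and the strong maximal inequality. -/
lemma fh_interp {M R p R' : ℝ} (hMp : M.HolderConjugate p) (hR : R.HolderConjugate R') (hRM : R ≤ M) :
    ∃ C : ℝ≥0∞, C ≠ ⊤ ∧ ∀ φ : ℝ → ℝ≥0∞, Measurable φ → ∃ Φ : ℝ → ℝ≥0∞, Measurable Φ ∧
      (∀ l : ℝ, 0 < l → ∀ τ, (ENNReal.ofReal l) ^ (1 + 1 / M - 1 / R) * ∫⁻ t, fhK l (t - τ) * φ t ≤ Φ τ) ∧
      (∫⁻ τ, Φ τ ^ R') ^ (1 / R') ≤ C * (∫⁻ t, φ t ^ p) ^ (1 / p) := by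
  obtain ⟨C₁, hC₁, hK⟩ := fhK_max
  obtain ⟨C₂, hC₂, hS⟩ := fhMax_strong p hMp.symm.lt
  have hM0 := hMp.pos
  have hp0 := hMp.symm.pos
  have hR0 := hR.pos
  have hR'0 := hR.symm.pos
  have hMs : M⁻¹ + p⁻¹ = 1 := hMp.inv_add_inv_eq_one
  have hRs : R⁻¹ + R'⁻¹ = 1 := hR.inv_add_inv_eq_one
  have hinv : M⁻¹ ≤ R⁻¹ := inv_anti₀ hR0 hRM
  have hpR : p ≤ R' := by
    have : R'⁻¹ ≤ p⁻¹ := by linarith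
    exact (inv_le_inv₀ hR'0 hp0).1 this
  set θ := p / R' with hθ
  have hθ0 : 0 ≤ θ := by positivity
  have hθ1 : 0 ≤ 1 - θ := by
    rw [sub_nonneg, hθ, div_le_iff₀ hR'0]; linarith
  refine ⟨C₁ ^ θ * C₂ ^ (1 / R'), ENNReal.mul_ne_top (ENNReal.rpow_ne_top_of_nonneg hθ0 hC₁)
    (ENNReal.rpow_ne_top_of_nonneg (by positivity) hC₂), ?_⟩
  intro φ hφ
  set N := (∫⁻ t, φ t ^ p) ^ (1 / p) with hN
  refine ⟨fun τ => (C₁ ^ θ * N ^ (1 - θ)) * fhMax φ τ ^ θ,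
    ((fhMax_measurable hφ).pow_const θ).const_mul _, ?_, ?_⟩
  · intro l hl τ
    set ℓ := ENNReal.ofReal l with hℓ
    have hℓ0 : ℓ ≠ 0 := by simpa [hℓ] using hl
    have hℓt : ℓ ≠ ⊤ := ENNReal.ofReal_ne_top
    set I := ∫⁻ t, fhK l (t - τ) * φ t with hI
    have h1 : ℓ * I ≤ C₁ * fhMax φ τ := hK φ hφ l hl τ
    have h2 : ℓ ^ (1 / M) * I ≤ N := by
      have h := ENNReal.lintegral_mul_le_Lp_mul_Lq volume hMp (f := fun t => fhK l (t - τ)) (g := φ)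
        (fhK_meas measurable_const (by fun_prop)).aemeasurable hφ.aemeasurable
      have h3 : I ≤ (ℓ⁻¹) ^ (1 / M) * N := by
        refine h.trans ?_
        rw [fh_shift_left]
        gcongr
        exact fhK_lintegral_rpow_le hl hMp.lt.le
      calc ℓ ^ (1 / M) * I ≤ ℓ ^ (1 / M) * ((ℓ⁻¹) ^ (1 / M) * N) := by gcongr
        _ = N := by
          rw [← mul_assoc, ← ENNReal.mul_rpow_of_nonneg _ _ (by positivity), ENNReal.mul_inv_cancel hℓ0 hℓt,
            ENNReal.one_rpow, one_mul]
    calc ℓ ^ (1 + 1 / M - 1 / R) * I = (ℓ * I) ^ θ * (ℓ ^ (1 / M) * I) ^ (1 - θ) := by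
          rw [ENNReal.mul_rpow_of_nonneg _ _ hθ0, ENNReal.mul_rpow_of_nonneg _ _ hθ1, ← ENNReal.rpow_mul]
          calc _ = ℓ ^ (θ + 1 / M * (1 - θ)) * I ^ (θ + (1 - θ)) := by
                rw [show θ + (1 - θ) = 1 by ring, ENNReal.rpow_one]
                congr 2
                have e1 : θ * p⁻¹ = R'⁻¹ := by rw [hθ]; field_simp
                have e2 : p⁻¹ = 1 - M⁻¹ := by linarith
                rw [e2] at e1
                simp only [one_div]
                linarith
            _ = _ := by
                rw [ENNReal.rpow_add _ _ hℓ0 hℓt, ENNReal.rpow_add_of_nonneg _ _ hθ0 hθ1]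
                ring
      _ ≤ (C₁ * fhMax φ τ) ^ θ * N ^ (1 - θ) := by gcongr
      _ = _ := by
          rw [ENNReal.mul_rpow_of_nonneg _ _ hθ0]; ring
  · have e : ∀ τ, ((C₁ ^ θ * N ^ (1 - θ)) * fhMax φ τ ^ θ) ^ R'
        = (C₁ ^ θ * N ^ (1 - θ)) ^ R' * fhMax φ τ ^ p := by
      intro τ
      rw [ENNReal.mul_rpow_of_nonneg _ _ hR'0.le, ← ENNReal.rpow_mul (fhMax φ τ)]
      congr 2
      rw [hθ]; field_simp
    simp only [e]
    rw [lintegral_const_mul _ ((fhMax_measurable hφ).pow_const p)]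
    calc _ ≤ ((C₁ ^ θ * N ^ (1 - θ)) ^ R' * (C₂ * ∫⁻ t, φ t ^ p)) ^ (1 / R') := by
          gcongr
          exact hS φ hφ
      _ = C₁ ^ θ * N ^ (1 - θ) * (C₂ ^ (1 / R') * N ^ θ) := by
          rw [ENNReal.mul_rpow_of_nonneg _ _ (by positivity), ENNReal.mul_rpow_of_nonneg C₂ _ (by positivity),
            ← ENNReal.rpow_mul (C₁ ^ θ * N ^ (1 - θ)), mul_one_div_cancel hR'0.ne', ENNReal.rpow_one]
          congr 2
          rw [hN, ← ENNReal.rpow_mul]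
          congr 1
          rw [hθ]; field_simp
      _ = C₁ ^ θ * C₂ ^ (1 / R') * (N ^ (1 - θ) * N ^ θ) := by ring
      _ = _ := by
          rw [← ENNReal.rpow_add_of_nonneg _ _ hθ1 hθ0, sub_add_cancel, ENNReal.rpow_one]

lemma fh_case_gt {m r : ℝ} (hr : 2 < r) (hrm : r ≤ m) :
    ∃ C : ℝ≥0∞, C ≠ ⊤ ∧ ∀ {L : X → ℝ}, Measurable L → (∀ ξ, 0 < L ξ) → ∀ {g : ℝ → X → ℝ≥0∞},
    Measurable (Function.uncurry g) →
    (∫⁻ t, (∫⁻ ξ, fhU L (1 + 1 / m - 1 / r) g t ξ ^ (2 : ℝ) ∂μ) ^ (m / 2)) ^ (1 / m) ≤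
      C * (∫⁻ t, (∫⁻ ξ, g t ξ ^ (2 : ℝ) ∂μ) ^ (r / 2)) ^ (1 / r) := by
  have hm0 : 0 < m := by linarith
  have hr0 : 0 < r := by linarith
  have hMp := Real.HolderConjugate.conjExponent (by linarith : 1 < m / 2)
  have hRR := Real.HolderConjugate.conjExponent (by linarith : 1 < r / 2)
  set p := (m / 2).conjExponent
  set R' := (r / 2).conjExponent
  obtain ⟨C, hC, hint⟩ := fh_interp hMp hRR (by linarith)
  refine ⟨C ^ ((1 : ℝ) / 2), ENNReal.rpow_ne_top_of_nonneg (by norm_num) hC, ?_⟩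
  intro L hL hL0 g hg
  set c := 1 + 1 / (m / 2) - 1 / (r / 2) with hc
  have hℓm : Measurable fun ξ => (ENNReal.ofReal (L ξ)) ^ c := (ENNReal.measurable_ofReal.comp hL).pow_const c
  have hh : Measurable (Function.uncurry fun τ ξ => g τ ξ ^ (2 : ℝ)) := hg.pow_const 2
  let V : ℝ → X → ℝ≥0∞ := fhU L c (fun τ ξ => g τ ξ ^ (2 : ℝ))
  have hV : Measurable (Function.uncurry V) := fhU_measurable hL c hh
  let F : ℝ → ℝ≥0∞ := fun t => ∫⁻ ξ, V t ξ ∂μ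
  have hF : Measurable F := Measurable.lintegral_prod_right hV
  have hUV : ∀ t ξ, fhU L (1 + 1 / m - 1 / r) g t ξ ^ (2 : ℝ) ≤ V t ξ := by
    intro t ξ
    have hℓ0 : ENNReal.ofReal (L ξ) ≠ 0 := by simpa using hL0 ξ
    have hℓt : ENNReal.ofReal (L ξ) ≠ ⊤ := ENNReal.ofReal_ne_top
    have h := fhK_holder (g := fun τ => g τ ξ) (hg.comp (by fun_prop : Measurable fun τ => (τ, ξ)))
      (hL0 ξ) (a := 2) (by norm_num) t
    simp only [V, fhU]
    rw [ENNReal.mul_rpow_of_nonneg _ _ (by norm_num), ← ENNReal.rpow_mul]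
    refine (mul_le_mul_right h _).trans (le_of_eq ?_)
    rw [← mul_assoc, ← ENNReal.rpow_add _ _ hℓ0 hℓt]
    congr 2
    rw [hc]; field_simp; ring
  set H := (∫⁻ t, (∫⁻ ξ, g t ξ ^ (2 : ℝ) ∂μ) ^ (r / 2)) ^ (1 / (r / 2)) with hH
  have hHm : Measurable fun t => ∫⁻ ξ, g t ξ ^ (2 : ℝ) ∂μ := Measurable.lintegral_prod_right hh
  have key : (∫⁻ t, F t ^ (m / 2)) ^ (1 / (m / 2)) ≤ C * H := by
    refine fh_duality volume hF hMp _ ?_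
    intro φ hφ
    obtain ⟨Φ, hΦm, hΦ, hΦn⟩ := hint φ hφ
    have hm3 : Measurable fun z : (ℝ × X) × ℝ =>
        (ENNReal.ofReal (L z.1.2)) ^ c * (fhK (L z.1.2) (z.1.1 - z.2) * g z.2 z.1.2 ^ (2 : ℝ)) * φ z.1.1 := by
      refine Measurable.mul (Measurable.mul ?_ (Measurable.mul ?_ ?_)) (hφ.comp (by fun_prop))
      · exact hℓm.comp (by fun_prop : Measurable fun z : (ℝ × X) × ℝ => z.1.2)
      · exact fhK_meas (hL.comp (by fun_prop)) (by fun_prop)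
      · exact (hg.comp (by fun_prop : Measurable fun z : (ℝ × X) × ℝ => (z.2, z.1.2))).pow_const 2
    have hgx : ∀ ξ, Measurable fun τ => g τ ξ := fun ξ =>
      hg.comp (by fun_prop : Measurable fun τ => (τ, ξ))
    calc ∫⁻ t, F t * φ t
        = ∫⁻ t, ∫⁻ ξ, V t ξ * φ t ∂μ := by
          refine lintegral_congr fun t => ?_
          rw [lintegral_mul_const]
          exact hV.comp (by fun_prop : Measurable fun ξ => (t, ξ))
      _ = ∫⁻ ξ, (∫⁻ t, V t ξ * φ t) ∂μ := by
          refine lintegral_lintegral_swap (Measurable.aemeasurable ?_)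
          exact hV.mul (hφ.comp measurable_fst)
      _ = ∫⁻ ξ, (∫⁻ t, ∫⁻ τ,
            (ENNReal.ofReal (L ξ)) ^ c * (fhK (L ξ) (t - τ) * g τ ξ ^ (2 : ℝ)) * φ t) ∂μ := by
          refine lintegral_congr fun ξ => lintegral_congr fun t => ?_
          have hk : Measurable fun τ => fhK (L ξ) (t - τ) * g τ ξ ^ (2 : ℝ) :=
            (fhK_meas measurable_const (by fun_prop)).mul ((hgx ξ).pow_const 2)
          rw [lintegral_mul_const _ (hk.const_mul _), lintegral_const_mul _ hk]
          rfl
      _ = ∫⁻ ξ, (∫⁻ τ, ∫⁻ t,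
            (ENNReal.ofReal (L ξ)) ^ c * (fhK (L ξ) (t - τ) * g τ ξ ^ (2 : ℝ)) * φ t) ∂μ := by
          refine lintegral_congr fun ξ => ?_
          refine lintegral_lintegral_swap (Measurable.aemeasurable ?_)
          exact hm3.comp (by fun_prop : Measurable fun z : ℝ × ℝ => ((z.1, ξ), z.2))
      _ ≤ ∫⁻ ξ, (∫⁻ τ, g τ ξ ^ (2 : ℝ) * Φ τ) ∂μ := by
          refine lintegral_mono fun ξ => lintegral_mono fun τ => ?_
          refine le_trans (le_of_eq ?_) (mul_le_mul_right (hΦ (L ξ) (hL0 ξ) τ) (g τ ξ ^ (2 : ℝ)))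
          have hk : Measurable fun t => fhK (L ξ) (t - τ) * φ t :=
            (fhK_meas measurable_const (by fun_prop)).mul hφ
          rw [← lintegral_const_mul _ hk, ← lintegral_const_mul _ (hk.const_mul _)]
          refine lintegral_congr fun t => ?_
          rw [hc]
          ring
      _ = ∫⁻ τ, ∫⁻ ξ, g τ ξ ^ (2 : ℝ) * Φ τ ∂μ := by
          refine lintegral_lintegral_swap (Measurable.aemeasurable ?_)
          exact (hh.comp measurable_swap).mul (hΦm.comp measurable_snd)
      _ = ∫⁻ τ, (∫⁻ ξ, g τ ξ ^ (2 : ℝ) ∂μ) * Φ τ := by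
          refine lintegral_congr fun τ => ?_
          rw [lintegral_mul_const]
          exact hh.comp (by fun_prop : Measurable fun ξ => (τ, ξ))
      _ ≤ H * (∫⁻ τ, Φ τ ^ R') ^ (1 / R') :=
          ENNReal.lintegral_mul_le_Lp_mul_Lq volume hRR hHm.aemeasurable hΦm.aemeasurable
      _ ≤ H * (C * (∫⁻ t, φ t ^ p) ^ (1 / p)) := by gcongr
      _ = _ := by ring
  calc _ ≤ (∫⁻ t, F t ^ (m / 2)) ^ (1 / m) := by
        refine ENNReal.rpow_le_rpow (lintegral_mono fun t => ?_) (by positivity)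
        exact ENNReal.rpow_le_rpow (lintegral_mono fun ξ => hUV t ξ) (by positivity)
    _ = ((∫⁻ t, F t ^ (m / 2)) ^ (1 / (m / 2))) ^ ((1 : ℝ) / 2) := by
        rw [← ENNReal.rpow_mul]; congr 1; field_simp
    _ ≤ (C * H) ^ ((1 : ℝ) / 2) := by gcongr
    _ = _ := by
        rw [ENNReal.mul_rpow_of_nonneg _ _ (by norm_num), hH, ← ENNReal.rpow_mul]
        congr 2; field_simp

lemma fh_core {m r : ℝ} (hm : 2 ≤ m) (hr : 1 < r) (hrm : r ≤ m) :
    ∃ C : ℝ≥0∞, C ≠ ⊤ ∧ ∀ {L : X → ℝ}, Measurable L → (∀ ξ, 0 < L ξ) → ∀ {g : ℝ → X → ℝ≥0∞},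
    Measurable (Function.uncurry g) →
    (∫⁻ t, (∫⁻ ξ, fhU L (1 + 1 / m - 1 / r) g t ξ ^ (2 : ℝ) ∂μ) ^ (m / 2)) ^ (1 / m) ≤
      C * (∫⁻ t, (∫⁻ ξ, g t ξ ^ (2 : ℝ) ∂μ) ^ (r / 2)) ^ (1 / r) := by
  rcases le_or_gt r 2 with h | h
  · refine ⟨1, by simp, ?_⟩
    intro L hL hL0 g hg
    rw [one_mul]
    exact fh_case_le μ hL hL0 hg hm hr h
  · exact fh_case_gt μ h hrm

end core

section norm
variable {X : Type*} [MeasurableSpace X] (μ : Measure X) [SigmaFinite μ]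

lemma fh_norm_add {U V : ℝ → X → ℝ≥0∞} (hU : Measurable (Function.uncurry U))
    (hV : Measurable (Function.uncurry V)) {m : ℝ} (hm : 2 ≤ m) :
    (∫⁻ t, (∫⁻ ξ, (U t ξ + V t ξ) ^ (2 : ℝ) ∂μ) ^ (m / 2)) ^ (1 / m) ≤
      (∫⁻ t, (∫⁻ ξ, U t ξ ^ (2 : ℝ) ∂μ) ^ (m / 2)) ^ (1 / m) +
      (∫⁻ t, (∫⁻ ξ, V t ξ ^ (2 : ℝ) ∂μ) ^ (m / 2)) ^ (1 / m) := by
  have hm0 : 0 < m := by linarith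
  have e : ∀ x : ℝ≥0∞, x ^ (m / 2) = (x ^ ((1 : ℝ) / 2)) ^ m := by
    intro x; rw [← ENNReal.rpow_mul]; congr 1; ring
  simp only [e]
  have hmeas : ∀ {W : ℝ → X → ℝ≥0∞}, Measurable (Function.uncurry W) →
      Measurable fun t => (∫⁻ ξ, W t ξ ^ (2 : ℝ) ∂μ) ^ ((1 : ℝ) / 2) := fun {W} hW =>
    (Measurable.lintegral_prod_right (f := fun t ξ => W t ξ ^ (2 : ℝ)) (hW.pow_const 2)).pow_const _
  refine le_trans ?_ (ENNReal.lintegral_Lp_add_le (hmeas hU).aemeasurable (hmeas hV).aemeasurable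
    (by linarith : 1 ≤ m))
  refine ENNReal.rpow_le_rpow (lintegral_mono fun t => ?_) (by positivity)
  refine ENNReal.rpow_le_rpow ?_ hm0.le
  exact ENNReal.lintegral_Lp_add_le (hU.comp (by fun_prop : Measurable fun ξ => (t, ξ))).aemeasurable
    (hV.comp (by fun_prop : Measurable fun ξ => (t, ξ))).aemeasurable (by norm_num)

lemma fh_norm_smul {U : ℝ → X → ℝ≥0∞} {m : ℝ} (hm : 2 ≤ m) (k : ℝ≥0∞) (hk : k ≠ ⊤) :
    (∫⁻ t, (∫⁻ ξ, (k * U t ξ) ^ (2 : ℝ) ∂μ) ^ (m / 2)) ^ (1 / m) =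
      k * (∫⁻ t, (∫⁻ ξ, U t ξ ^ (2 : ℝ) ∂μ) ^ (m / 2)) ^ (1 / m) := by
  have hm0 : 0 < m := by linarith
  have hk2 : k ^ (2 : ℝ) ≠ ⊤ := ENNReal.rpow_ne_top_of_nonneg (by norm_num) hk
  have hkm : k ^ m ≠ ⊤ := ENNReal.rpow_ne_top_of_nonneg hm0.le hk
  have e : ∀ t, (∫⁻ ξ, (k * U t ξ) ^ (2 : ℝ) ∂μ) ^ (m / 2)
      = k ^ m * (∫⁻ ξ, U t ξ ^ (2 : ℝ) ∂μ) ^ (m / 2) := by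
    intro t
    simp only [ENNReal.mul_rpow_of_nonneg _ _ (by norm_num : (0 : ℝ) ≤ 2)]
    rw [lintegral_const_mul' _ _ hk2, ENNReal.mul_rpow_of_nonneg _ _ (by positivity), ← ENNReal.rpow_mul]
    congr 2; ring
  simp only [e]
  rw [lintegral_const_mul' _ _ hkm, ENNReal.mul_rpow_of_nonneg _ _ (by positivity), ← ENNReal.rpow_mul,
    mul_one_div_cancel hm0.ne', ENNReal.rpow_one]

end norm

lemma fh_sq_eq (x a : ℝ) (hx : 0 ≤ x) (z : ℂ) :
    ENNReal.ofReal (x ^ (2 * a) * ‖z‖ ^ 2) = (ENNReal.ofReal (x ^ a) * ‖z‖ₑ) ^ (2 : ℝ) := by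
  rw [← ofReal_norm_eq_enorm, ← ENNReal.ofReal_mul (by positivity),
    ENNReal.ofReal_rpow_of_nonneg (by positivity) (by norm_num)]
  congr 1
  rw [Real.mul_rpow (by positivity) (by positivity), ← Real.rpow_mul hx, mul_comm a 2]
  norm_num

lemma fh_weight (x ν α a b e : ℝ) (hx : 0 < x) (hν : 0 < ν) (h : a = b + 2 * α * e) :
    ENNReal.ofReal (x ^ a) =
      ENNReal.ofReal (ν ^ (-e)) * (ENNReal.ofReal (ν * x ^ (2 * α)) ^ e * ENNReal.ofReal (x ^ b)) := by
  have hp : 0 < ν * x ^ (2 * α) := by positivity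
  rw [ENNReal.ofReal_rpow_of_pos hp, ← ENNReal.ofReal_mul (by positivity), ← ENNReal.ofReal_mul (by positivity)]
  congr 1
  rw [h, Real.rpow_add hx, Real.mul_rpow hν.le (by positivity), ← Real.rpow_mul hx.le, Real.rpow_neg hν.le]
  have : ν ^ e ≠ 0 := by positivity
  field_simp

lemma fh_timeInterval_meas (T : ℝ≥0∞) : MeasurableSet (timeInterval T) :=
  (measurableSet_lt measurable_const measurable_id).inter
    (measurableSet_lt ENNReal.measurable_ofReal measurable_const)

lemma fh_duhamel_bound (d : ℕ) (α ν : ℝ) (T : ℝ≥0∞) (w₀ : EuclideanSpace ℝ (Fin d) → ℂ)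
    (f : ℝ → EuclideanSpace ℝ (Fin d) → ℂ) (t : ℝ) (ht : t ∈ timeInterval T) (ξ : EuclideanSpace ℝ (Fin d)) :
    ‖duhamelFourier d α ν w₀ f t ξ‖ₑ ≤ fhK (ν * ‖ξ‖ ^ (2 * α)) t * ‖w₀ ξ‖ₑ +
      ∫⁻ τ, fhK (ν * ‖ξ‖ ^ (2 * α)) (t - τ) * (timeInterval T).indicator (fun τ => ‖f τ ξ‖ₑ) τ := by
  have ht0 : 0 < t := ht.1
  have htT : ENNReal.ofReal t < T := ht.2
  unfold duhamelFourier
  refine (enorm_add_le _ _).trans (add_le_add (le_of_eq ?_) ?_)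
  · rw [enorm_smul, Real.enorm_of_nonneg (Real.exp_pos _).le]
    simp only [fhK, ht0, if_true]
    congr 3; ring
  · rw [intervalIntegral.integral_of_le ht0.le, ← restrict_Ioo_eq_restrict_Ioc]
    refine (enorm_integral_le_lintegral_enorm _).trans ?_
    rw [← lintegral_indicator measurableSet_Ioo]
    refine lintegral_mono fun τ => ?_
    by_cases hτ : τ ∈ Set.Ioo 0 t
    · have hS : τ ∈ timeInterval T :=
        ⟨hτ.1, lt_of_le_of_lt (ENNReal.ofReal_le_ofReal hτ.2.le) htT⟩
      have h1 : 0 < t - τ := sub_pos.2 hτ.2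
      rw [Set.indicator_of_mem hτ, Set.indicator_of_mem hS, enorm_smul,
        Real.enorm_of_nonneg (Real.exp_pos _).le]
      simp only [fhK, h1, if_true]
      refine le_of_eq ?_
      congr 3; ring
    · rw [Set.indicator_of_notMem hτ]; exact zero_le

/-- **`L²`-based maximal regularity for the fractional heat equation in Fourier variables**
(the `p = q = 2` case of Proposition `pro-F_heat`): with `ŵ` the Duhamel solution,
`‖w‖_{L^m(0,T;Ḣ^{δ₀+2α+2α/m})} ≤ C₁ ‖f‖_{L^r(0,T;Ḣ^{δ₀+2α/r})} + C₂ ‖w₀‖_{Ḣ^{δ₀+2α}}`,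
expressed via Fourier-side homogeneous Sobolev norms, as an inequality in `[0,∞]`.
Here `C₂` does not depend on `r`. -/
theorem fractional_heat_maximal_regularity_L2
    (d : ℕ) (hd : 1 ≤ d) (α : ℝ) (hα : 0 ≤ α) (ν : ℝ) (hν : 0 < ν) (δ₀ : ℝ)
    (m : ℝ) (hm : 2 ≤ m) :
    ∃ C₂ : ℝ, 0 < C₂ ∧
      ∀ r : ℝ, 1 < r → r ≤ m →
        ∃ C₁ : ℝ, 0 < C₁ ∧
          ∀ T : ℝ≥0∞, 0 < T →
            ∀ w₀ : EuclideanSpace ℝ (Fin d) → ℂ, Measurable w₀ →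
              ∀ f : ℝ → EuclideanSpace ℝ (Fin d) → ℂ,
                Measurable (Function.uncurry f) →
                (∀ᵐ ξ : EuclideanSpace ℝ (Fin d),
                  LocallyIntegrableOn (fun τ => f τ ξ) (timeInterval T)) →
                (∫⁻ t in timeInterval T,
                    (∫⁻ ξ : EuclideanSpace ℝ (Fin d),
                      ENNReal.ofReal (‖ξ‖ ^ (2 * (δ₀ + 2 * α + 2 * α / m)) *
                        ‖duhamelFourier d α ν w₀ f t ξ‖ ^ 2)) ^ (m / 2)) ^ (1 / m) ≤
                  ENNReal.ofReal C₁ *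
                    (∫⁻ t in timeInterval T,
                      (∫⁻ ξ : EuclideanSpace ℝ (Fin d),
                        ENNReal.ofReal (‖ξ‖ ^ (2 * (δ₀ + 2 * α / r)) *
                          ‖f t ξ‖ ^ 2)) ^ (r / 2)) ^ (1 / r) +
                  ENNReal.ofReal C₂ *
                    (∫⁻ ξ : EuclideanSpace ℝ (Fin d),
                      ENNReal.ofReal (‖ξ‖ ^ (2 * (δ₀ + 2 * α)) *
                        ‖w₀ ξ‖ ^ 2)) ^ ((1 : ℝ) / 2) := by
  have hm0 : 0 < m := by linarith
  refine ⟨ν ^ (-(1 / m)), by positivity, ?_⟩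
  intro r hr hrm
  have hr0 : 0 < r := by linarith
  obtain ⟨C, hC, hcore⟩ := fh_core (volume : Measure (EuclideanSpace ℝ (Fin d))) hm hr hrm
  set c := 1 + 1 / m - 1 / r with hc
  refine ⟨ν ^ (-c) * (C.toReal + 1), by positivity, ?_⟩
  intro T _ w₀ hw₀ f hf _
  haveI : Nonempty (Fin d) := ⟨⟨0, hd⟩⟩
  have hSm := fh_timeInterval_meas T
  set S := timeInterval T with hS
  let L : EuclideanSpace ℝ (Fin d) → ℝ := fun ξ => if ξ = 0 then 1 else ν * ‖ξ‖ ^ (2 * α)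
  have hL : Measurable L := by
    refine Measurable.ite (measurableSet_singleton 0) measurable_const ?_
    fun_prop
  have hL0 : ∀ ξ, 0 < L ξ := by
    intro ξ
    by_cases h : ξ = 0
    · simp [L, h]
    · have : 0 < ‖ξ‖ := norm_pos_iff.2 h
      simp only [L, h, if_false]
      positivity
  let v : EuclideanSpace ℝ (Fin d) → ℝ≥0∞ := fun ξ => ENNReal.ofReal (‖ξ‖ ^ (δ₀ + 2 * α)) * ‖w₀ ξ‖ₑ
  have hv : Measurable v := by
    refine Measurable.mul (by fun_prop) hw₀.enorm
  let g : ℝ → EuclideanSpace ℝ (Fin d) → ℝ≥0∞ := fun τ ξ =>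
    ENNReal.ofReal (‖ξ‖ ^ (δ₀ + 2 * α / r)) * S.indicator (fun τ => ‖f τ ξ‖ₑ) τ
  have hg : Measurable (Function.uncurry g) := by
    refine Measurable.mul (by fun_prop) ?_
    exact Measurable.indicator (f := fun z : ℝ × EuclideanSpace ℝ (Fin d) => ‖f z.1 z.2‖ₑ)
      (s := Prod.fst ⁻¹' S) hf.enorm (measurable_fst hSm)
  let A : ℝ → EuclideanSpace ℝ (Fin d) → ℝ≥0∞ := fun t ξ =>
    (ENNReal.ofReal (L ξ)) ^ (1 / m) * fhK (L ξ) t * v ξ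
  have hA : Measurable (Function.uncurry A) := by
    refine Measurable.mul (Measurable.mul ?_ ?_) (hv.comp measurable_snd)
    · exact (ENNReal.measurable_ofReal.comp (hL.comp measurable_snd)).pow_const _
    · exact fhK_meas (hL.comp measurable_snd) measurable_fst
  have hU := fhU_measurable hL c hg
  set k₁ := ENNReal.ofReal (ν ^ (-c)) with hk₁
  set k₂ := ENNReal.ofReal (ν ^ (-(1 / m))) with hk₂
  have hpt : ∀ t ∈ S, ∀ ξ : EuclideanSpace ℝ (Fin d), ξ ≠ 0 →
      ENNReal.ofReal (‖ξ‖ ^ (2 * (δ₀ + 2 * α + 2 * α / m)) * ‖duhamelFourier d α ν w₀ f t ξ‖ ^ 2) ≤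
        (k₂ * A t ξ + k₁ * fhU L c g t ξ) ^ (2 : ℝ) := by
    intro t ht ξ hξ
    have hx : 0 < ‖ξ‖ := norm_pos_iff.2 hξ
    have hLξ : L ξ = ν * ‖ξ‖ ^ (2 * α) := by simp [L, hξ]
    rw [fh_sq_eq _ _ hx.le]
    refine ENNReal.rpow_le_rpow ?_ (by norm_num)
    refine (mul_le_mul_right (fh_duhamel_bound d α ν T w₀ f t ht ξ) _).trans (le_of_eq ?_)
    rw [mul_add]
    congr 1
    · rw [fh_weight ‖ξ‖ ν α _ (δ₀ + 2 * α) (1 / m) hx hν (by ring)]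
      simp only [A, v, hLξ]
      ring
    · rw [fh_weight ‖ξ‖ ν α _ (δ₀ + 2 * α / r) c hx hν (by rw [hc]; ring)]
      simp only [fhU, g, hLξ]
      rw [mul_assoc, mul_assoc, ← lintegral_const_mul' _ _ ENNReal.ofReal_ne_top]
      congr 2
      refine lintegral_congr fun τ => ?_
      ring
  have hne : ∀ᵐ ξ : EuclideanSpace ℝ (Fin d), ξ ≠ 0 := by
    rw [ae_iff]; simp
  have hLHS : (∫⁻ t in S, (∫⁻ ξ : EuclideanSpace ℝ (Fin d),
      ENNReal.ofReal (‖ξ‖ ^ (2 * (δ₀ + 2 * α + 2 * α / m)) *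
        ‖duhamelFourier d α ν w₀ f t ξ‖ ^ 2)) ^ (m / 2)) ^ (1 / m) ≤
      (∫⁻ t, (∫⁻ ξ, (k₂ * A t ξ + k₁ * fhU L c g t ξ) ^ (2 : ℝ)) ^ (m / 2)) ^ (1 / m) := by
    refine ENNReal.rpow_le_rpow ?_ (by positivity)
    refine (setLIntegral_mono' hSm fun t ht => ?_).trans (setLIntegral_le_lintegral S _)
    refine ENNReal.rpow_le_rpow (lintegral_mono_ae ?_) (by positivity)
    filter_upwards [hne] with ξ hξ
    exact hpt t ht ξ hξ
  have hRf : ∫⁻ t in S, (∫⁻ ξ : EuclideanSpace ℝ (Fin d),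
        ENNReal.ofReal (‖ξ‖ ^ (2 * (δ₀ + 2 * α / r)) * ‖f t ξ‖ ^ 2)) ^ (r / 2)
      = ∫⁻ t, (∫⁻ ξ, g t ξ ^ (2 : ℝ)) ^ (r / 2) := by
    rw [← lintegral_indicator hSm]
    refine lintegral_congr fun t => ?_
    by_cases ht : t ∈ S
    · simp only [Set.indicator_of_mem ht, g, fh_sq_eq _ _ (norm_nonneg _)]
    · have : 0 < r / 2 := by positivity
      simp only [Set.indicator_of_notMem ht, g, mul_zero]
      simp [this]
  have hRw : (∫⁻ ξ : EuclideanSpace ℝ (Fin d),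
        ENNReal.ofReal (‖ξ‖ ^ (2 * (δ₀ + 2 * α)) * ‖w₀ ξ‖ ^ 2)) = ∫⁻ ξ, v ξ ^ (2 : ℝ) := by
    simp only [v, fh_sq_eq _ _ (norm_nonneg _)]
  rw [hRf, hRw]
  refine hLHS.trans ?_
  refine (fh_norm_add volume (U := fun t ξ => k₂ * A t ξ) (V := fun t ξ => k₁ * fhU L c g t ξ)
    (hA.const_mul k₂) (hU.const_mul k₁) hm).trans ?_
  rw [fh_norm_smul volume hm k₂ ENNReal.ofReal_ne_top, fh_norm_smul volume hm k₁ ENNReal.ofReal_ne_top, add_comm]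
  refine add_le_add ?_ ?_
  · rw [ENNReal.ofReal_mul (by positivity), mul_assoc]
    refine mul_le_mul_right ((hcore hL hL0 hg).trans ?_) _
    refine mul_le_mul_left ?_ _
    rw [← ENNReal.ofReal_toReal hC]
    refine ENNReal.ofReal_le_ofReal ?_
    rw [ENNReal.toReal_ofReal ENNReal.toReal_nonneg]
    linarith
  · exact mul_le_mul_right (fh_termA volume hL hL0 hv hm) _

end
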